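/- Let n ≥ 1 and let φ_1, …, φ_n and b_1, …, b_n be nonzero vectors in ℂ². If U_1, …, U_n are independent random elements of SU(2), each distributed according to the Haar probability measure μ, then with probability one the following holds simultaneously for every n-qubit Pauli string Q = τ_1 ⊗ ⋯ ⊗ τ_n with τ_j ∈ {I, σ_x, σ_y, σ_z}: the overlap ⟨b_1 ⊗ ⋯ ⊗ b_n, Q·(U_1 ⊗ ⋯ ⊗ U_n)(φ_1 ⊗ ⋯ ⊗ φ_n)⟩ is nonzero. That is, the probability that at least one of the 4^n Pauli-string overlaps vanishes is zero. -/

import Mathlib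

open MeasureTheory Matrix

noncomputable section

/-- `SU(2)`: the subgroup of the `2 × 2` complex unitary group consisting of matrices of
determinant `1`. -/
def SU2 : Subgroup (Matrix.unitaryGroup (Fin 2) ℂ) where
  carrier := {U | (U : Matrix (Fin 2) (Fin 2) ℂ).det = 1}
  one_mem' := by simp
  mul_mem' := by
    intro a b ha hb
    simp only [Set.mem_setOf_eq] at *
    rw [Matrix.UnitaryGroup.mul_val, Matrix.det_mul, ha, hb, mul_one]
  inv_mem' := by
    intro a ha
    simp only [Set.mem_setOf_eq] at *
    rw [Matrix.UnitaryGroup.inv_val, Matrix.star_eq_conjTranspose,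
      Matrix.det_conjTranspose, ha, star_one]

/-- The underlying `2 × 2` complex matrix of an element of `SU(2)`. -/
def SU2.mat (U : SU2) : Matrix (Fin 2) (Fin 2) ℂ := U.1.1

/-- The Hermitian inner product `⟨u, v⟩ = ∑ i, conj (u i) * v i`, conjugate-linear in the
first argument. -/
def hInner {ι : Type*} [Fintype ι] (u v : ι → ℂ) : ℂ :=
  ∑ i, starRingEnd ℂ (u i) * v i

/-- The four single-qubit Pauli matrices `I, σ_x, σ_y, σ_z`. -/
def pauli : Fin 4 → Matrix (Fin 2) (Fin 2) ℂ
  | 0 => 1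
  | 1 => !![0, 1; 1, 0]
  | 2 => !![0, -Complex.I; Complex.I, 0]
  | 3 => !![1, 0; 0, -1]

/-- The `n`-qubit Pauli string `τ₁ ⊗ ⋯ ⊗ τₙ`, as a matrix on `(ℂ²)^{⊗n}` (realized as
functions `(Fin n → Fin 2) → ℂ`). -/
def pauliString {n : ℕ} (τ : Fin n → Fin 4) :
    Matrix (Fin n → Fin 2) (Fin n → Fin 2) ℂ :=
  fun x y => ∏ j, pauli (τ j) (x j) (y j)

/-- The elementary tensor `f 1 ⊗ ⋯ ⊗ f n` of single-qubit vectors, as a vector of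
`(ℂ²)^{⊗n}` (realized as functions `(Fin n → Fin 2) → ℂ`). -/
def tensorVec {n : ℕ} (f : (j : Fin n) → Fin 2 → ℂ) : (Fin n → Fin 2) → ℂ :=
  fun x => ∏ j, f j (x j)

theorem pauli_mul_self (i : Fin 4) : pauli i * pauli i = 1 := by
  fin_cases i <;> ext a b <;> fin_cases a <;> fin_cases b <;> simp [pauli, Matrix.mul_apply]

theorem pauliString_mulVec_tensorVec {n : ℕ} (τ : Fin n → Fin 4) (v : Fin n → Fin 2 → ℂ) :
    (pauliString τ).mulVec (tensorVec v) = tensorVec fun j => (pauli (τ j)).mulVec (v j) := by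
  ext x
  simp only [Matrix.mulVec, dotProduct, pauliString, tensorVec, ← Finset.prod_mul_distrib,
    Finset.prod_univ_sum, Fintype.piFinset_univ]

theorem hInner_tensorVec {n : ℕ} (b v : Fin n → Fin 2 → ℂ) :
    hInner (tensorVec b) (tensorVec v) = ∏ j, star (b j) ⬝ᵥ v j := by
  simp only [hInner, tensorVec, dotProduct, map_prod, ← Finset.prod_mul_distrib,
    Finset.prod_univ_sum, Fintype.piFinset_univ, Pi.star_apply, starRingEnd_apply]

theorem SU2.mat_mul (U V : SU2) : SU2.mat (U * V) = SU2.mat U * SU2.mat V := rfl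

theorem SU2.continuous_mat : Continuous SU2.mat :=
  continuous_subtype_val.comp continuous_subtype_val

theorem SU2.mulVec_ne_zero (U : SU2) {φ : Fin 2 → ℂ} (hφ : φ ≠ 0) :
    (SU2.mat U).mulVec φ ≠ 0 := by
  intro h
  apply hφ
  have hU : star (SU2.mat U) * SU2.mat U = 1 := Matrix.UnitaryGroup.star_mul_self U.1
  rw [← Matrix.one_mulVec φ, ← hU, ← Matrix.mulVec_mulVec, h, Matrix.mulVec_zero]

/-- The element of `SU(2)` with first column `(α, β)`. -/
def SU2.ofColumn (α β : ℂ) (h : α * star α + β * star β = 1) : SU2 :=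
  ⟨⟨!![α, -star β; β, star α], by
    rw [Matrix.mem_unitaryGroup_iff]
    ext i j
    fin_cases i <;> fin_cases j <;>
      simp [Matrix.mul_apply, Fin.sum_univ_two] <;>
      simp only [RCLike.star_def] at h <;> first | ring1 | linear_combination h⟩, by
    change Matrix.det !![α, -star β; β, star α] = 1
    rw [Matrix.det_fin_two_of]
    linear_combination h⟩

theorem SU2.dotProduct_ofColumn_mulVec (α β : ℂ) (h : α * star α + β * star β = 1)
    (c w : Fin 2 → ℂ) :
    c ⬝ᵥ (SU2.mat (SU2.ofColumn α β h)).mulVec w =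
      (c 0 * α + c 1 * β) * w 0 + (c 1 * star α - c 0 * star β) * w 1 := by
  have hm : SU2.mat (SU2.ofColumn α β h) = !![α, -star β; β, star α] := rfl
  rw [hm]
  simp [dotProduct, Matrix.mulVec, Fin.sum_univ_two]
  ring

theorem eq_zero_of_two_linear_equations {p q r s : ℂ} (hD : p * s - q * r ≠ 0) {w : Fin 2 → ℂ}
    (h₁ : p * w 0 + q * w 1 = 0) (h₂ : r * w 0 + s * w 1 = 0) : w = 0 := by
  ext i
  apply mul_left_cancel₀ hD
  fin_cases i
  · simp only [Fin.zero_eta, Pi.zero_apply]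
    linear_combination s * h₁ - q * h₂
  · simp only [Fin.mk_one, Pi.zero_apply]
    linear_combination p * h₂ - r * h₁

theorem sin_inv_succ_sub_ne_zero {k l : ℕ} (hkl : k ≠ l) :
    Real.sin (1 / ((k : ℝ) + 1) - 1 / ((l : ℝ) + 1)) ≠ 0 := by
  have bound (m : ℕ) : 0 < 1 / ((m : ℝ) + 1) ∧ 1 / ((m : ℝ) + 1) ≤ 1 :=
    ⟨Nat.one_div_pos_of_nat, by
      rw [div_le_one (by positivity)]
      linarith [(Nat.cast_nonneg m : (0 : ℝ) ≤ m)]⟩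
  have hπ := Real.pi_gt_three
  rw [Ne, Real.sin_eq_zero_iff_of_lt_of_lt (by linarith [bound k, bound l])
    (by linarith [bound k, bound l]), sub_eq_zero]
  intro h
  rw [one_div, one_div, _root_.inv_inj, add_left_inj, Nat.cast_inj] at h
  exact hkl h

/-- Infinitely many elements of `SU(2)` carry a nonzero row vector to pairwise linearly independent
row vectors. -/
theorem SU2.exists_seq_pairwise_independent {c : Fin 2 → ℂ} (hc : c ≠ 0) :
    ∃ g : ℕ → SU2, ∀ k l, k ≠ l → ∀ w : Fin 2 → ℂ,
      c ⬝ᵥ (SU2.mat (g k)).mulVec w = 0 → c ⬝ᵥ (SU2.mat (g l)).mulVec w = 0 → w = 0 := by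
  let θ (k : ℕ) : ℝ := 1 / ((k : ℝ) + 1)
  have hcs (k : ℕ) : (Real.cos (θ k) : ℂ) ^ 2 + (Real.sin (θ k) : ℂ) ^ 2 = 1 := by
    exact_mod_cast Real.cos_sq_add_sin_sq (θ k)
  have hsin {k l : ℕ} (hkl : k ≠ l) : (Real.sin (θ k) : ℂ) * Real.cos (θ l) -
      Real.cos (θ k) * Real.sin (θ l) ≠ 0 := by
    have := sin_inv_succ_sub_ne_zero hkl
    rw [Real.sin_sub] at this
    simpa only [← Complex.ofReal_mul, ← Complex.ofReal_sub, Complex.ofReal_ne_zero] using this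
  by_cases h01 : c 0 * c 1 = 0
  · refine ⟨fun k => SU2.ofColumn (Real.cos (θ k)) (Real.sin (θ k)) ?_, ?_⟩
    · simp only [RCLike.star_def, Complex.conj_ofReal]
      linear_combination hcs k
    · intro k l hkl w h₁ h₂
      rw [SU2.dotProduct_ofColumn_mulVec] at h₁ h₂
      refine eq_zero_of_two_linear_equations ?_ h₁ h₂
      have hsum : c 0 ^ 2 + c 1 ^ 2 ≠ 0 := by
        intro h
        apply hc
        have h0 : c 0 = 0 := by
          rcases mul_eq_zero.1 h01 with h' | h'
          · exact h'
          · simpa [h'] using h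
        have h1 : c 1 = 0 := by simpa [h0] using h
        ext i
        fin_cases i
        exacts [h0, h1]
      convert mul_ne_zero hsum (hsin hkl) using 1
      simp only [RCLike.star_def, Complex.conj_ofReal]
      ring
  · refine ⟨fun k => SU2.ofColumn (Real.cos (θ k) + Real.sin (θ k) * Complex.I) 0 ?_, ?_⟩
    · simp only [RCLike.star_def, map_add, map_mul, Complex.conj_ofReal, Complex.conj_I, map_zero]
      linear_combination hcs k - (Real.sin (θ k) : ℂ) ^ 2 * Complex.I_sq
    · intro k l hkl w h₁ h₂
      rw [SU2.dotProduct_ofColumn_mulVec] at h₁ h₂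
      refine eq_zero_of_two_linear_equations ?_ h₁ h₂
      convert mul_ne_zero (mul_ne_zero h01 (mul_ne_zero two_ne_zero Complex.I_ne_zero))
        (hsin hkl) using 1
      simp only [RCLike.star_def, map_add, map_mul, Complex.conj_ofReal, Complex.conj_I, map_zero]
      ring

theorem SU2.measure_dotProduct_mulVec_eq_zero [MeasurableSpace SU2] [BorelSpace SU2]
    (μ : Measure SU2) [μ.IsMulLeftInvariant] [IsFiniteMeasure μ] {c φ : Fin 2 → ℂ}
    (hc : c ≠ 0) (hφ : φ ≠ 0) : μ {U : SU2 | c ⬝ᵥ (SU2.mat U).mulVec φ = 0} = 0 := by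
  obtain ⟨g, hg⟩ := SU2.exists_seq_pairwise_independent hc
  set S : Set SU2 := {U : SU2 | c ⬝ᵥ (SU2.mat U).mulVec φ = 0} with hS
  have hclosed : IsClosed S := by
    refine isClosed_eq ?_ continuous_const
    exact continuous_const.dotProduct (SU2.continuous_mat.matrix_mulVec continuous_const)
  have hmeas (k : ℕ) : MeasurableSet ((fun U => g k * U) ⁻¹' S) :=
    (hclosed.preimage (continuous_const_mul (g k))).measurableSet
  have hdisj : Pairwise (Function.onFun Disjoint fun k => (fun U => g k * U) ⁻¹' S) := by
    intro k l hkl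
    refine Set.disjoint_left.2 fun U hk hl => SU2.mulVec_ne_zero U hφ ?_
    simp only [hS, Set.mem_preimage, Set.mem_ofPred_eq, SU2.mat_mul, ← Matrix.mulVec_mulVec]
      at hk hl
    exact hg k l hkl _ hk hl
  have hsum := measure_iUnion (μ := μ) hdisj hmeas
  simp only [measure_preimage_mul] at hsum
  by_contra h
  exact measure_ne_top μ _ (hsum.trans (ENNReal.tsum_const_eq_top_of_ne_zero h))

/-- If `U₁, …, Uₙ` are independent Haar-random elements of `SU(2)` and `φ₁, …, φₙ`,
`b₁, …, bₙ` are nonzero vectors in `ℂ²`, then with probability one every `n`-qubit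
Pauli-string overlap `⟨b₁ ⊗ ⋯ ⊗ bₙ, Q·(U₁ ⊗ ⋯ ⊗ Uₙ)(φ₁ ⊗ ⋯ ⊗ φₙ)⟩` is nonzero: the
probability that at least one of the `4^n` overlaps vanishes is zero. -/
theorem generic_sensitivity [MeasurableSpace SU2] [BorelSpace SU2]
    (μ : Measure SU2) [μ.IsHaarMeasure] [IsProbabilityMeasure μ]
    (n : ℕ) (hn : 1 ≤ n) (φ b : Fin n → Fin 2 → ℂ)
    (hφ : ∀ j, φ j ≠ 0) (hb : ∀ j, b j ≠ 0) :
    (Measure.pi fun _ : Fin n => μ)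
      {U : Fin n → SU2 | ∃ τ : Fin n → Fin 4,
        hInner (tensorVec b)
          ((pauliString τ).mulVec
            (tensorVec fun j => (SU2.mat (U j)).mulVec (φ j))) = 0} = 0 := by
  have hnull (j : Fin n) (i : Fin 4) : (Measure.pi fun _ : Fin n => μ)
      (Function.eval j ⁻¹'
        {V : SU2 | Matrix.vecMul (star (b j)) (pauli i) ⬝ᵥ (SU2.mat V).mulVec (φ j) = 0}) = 0 := by
    refine Measure.pi_eval_preimage_null _ (SU2.measure_dotProduct_mulVec_eq_zero μ ?_ (hφ j))
    intro h
    apply star_ne_zero.2 (hb j)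
    rw [← Matrix.vecMul_one (star (b j)), ← pauli_mul_self i, ← Matrix.vecMul_vecMul, h,
      Matrix.zero_vecMul]
  refine measure_mono_null ?_ (measure_iUnion_null fun j => measure_iUnion_null (hnull j))
  rintro U ⟨τ, h⟩
  rw [pauliString_mulVec_tensorVec, hInner_tensorVec, Finset.prod_eq_zero_iff] at h
  obtain ⟨j, -, hj⟩ := h
  rw [Matrix.dotProduct_mulVec] at hj
  exact Set.mem_iUnion₂.2 ⟨j, τ j, hj⟩

end
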